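/- Let Σ be a positive definite real matrix indexed by a finite set V, and let A, B, C ⊆ V be pairwise disjoint with A and B nonempty. Then the partial vector alienation coefficient λ_{A:B|C} = det Σ_{(A∪B)(A∪B)·C} / (det Σ_{AA·C} · det Σ_{BB·C}) satisfies 0 < λ_{A:B|C} ≤ 1; equivalently, the squared partial vector correlation ρ²_{A:B|C} = 1 − λ_{A:B|C} satisfies 0 ≤ ρ²_{A:B|C} < 1. -/

import Mathlib

open Matrix BigOperators

variable {V : Type*} [Fintype V] [DecidableEq V]

/-- Submatrix of `M` with rows indexed by `A` and columns indexed by `B`. -/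
def subm (M : Matrix V V ℝ) (A B : Finset V) : Matrix A B ℝ :=
  M.submatrix (fun i => (i : V)) (fun j => (j : V))

/-- Partial covariance matrix `Σ_{AA·B} = Σ_AA − Σ_AB (Σ_BB)⁻¹ Σ_BA`. -/
noncomputable def pcov (M : Matrix V V ℝ) (A B : Finset V) : Matrix A A ℝ :=
  subm M A A - subm M A B * (subm M B B)⁻¹ * subm M B A

/-- A matrix `K` indexed by `W` implies a graph `G` on `W` if every nonzero
off-diagonal entry of `K` corresponds to an edge of `G`. -/
def MatImplies {W : Type*} (K : Matrix W W ℝ) (G : SimpleGraph W) : Prop :=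
  ∀ u v : W, u ≠ v → K u v ≠ 0 → G.Adj u v

/-- Path weight `ω(π, Γ) = (−1)^{|P|+1} det(Γ_PP) ∏_{{u,v} ∈ E(π)} (Γ⁻¹)_uv`. -/
noncomputable def pathWeight {G : SimpleGraph V} {x y : V} (M : Matrix V V ℝ) (p : G.Walk x y) : ℝ :=
  (-1 : ℝ) ^ (p.support.toFinset.card + 1)
    * (subm M p.support.toFinset p.support.toFinset).det
    * (p.darts.map (fun d => M⁻¹ d.toProd.1 d.toProd.2)).prod

/-- Vector alienation coefficient `λ_{A:B}`. -/
noncomputable def alien (M : Matrix V V ℝ) (A B : Finset V) : ℝ :=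
  (subm M (A ∪ B) (A ∪ B)).det / ((subm M A A).det * (subm M B B).det)

/-- Squared vector correlation `ρ²_{A:B} = 1 − λ_{A:B}`. -/
noncomputable def rho2 (M : Matrix V V ℝ) (A B : Finset V) : ℝ :=
  1 - alien M A B

/-- Partial vector alienation coefficient `λ_{A:B|C}`. -/
noncomputable def alienCond (M : Matrix V V ℝ) (A B C : Finset V) : ℝ :=
  (pcov M (A ∪ B) C).det / ((pcov M A C).det * (pcov M B C).det)

/-- Squared partial vector correlation `ρ²_{A:B|C}`, with the convention that it
is `0` whenever `A = ∅` or `B = ∅`. -/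
noncomputable def rho2Cond (M : Matrix V V ℝ) (A B C : Finset V) : ℝ :=
  if A = ∅ ∨ B = ∅ then 0 else 1 - alienCond M A B C

/-- The limited-order networked partial covariance
`ω_{xy·Q} = ω(⟨x,y⟩, Σ_{(Q∪{x,y})(Q∪{x,y})})
          = (−1) · det(Σ_{{x,y}{x,y}}) · ((Σ_{(Q∪{x,y})(Q∪{x,y})})⁻¹)_{xy}`. -/
noncomputable def npcov (M : Matrix V V ℝ) (Q : Finset V) (x y : V) : ℝ :=
  (-1 : ℝ) * (subm M {x, y} {x, y}).det *
    (subm M (Q ∪ {x, y}) (Q ∪ {x, y}))⁻¹ ⟨x, by simp⟩ ⟨y, by simp⟩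

section Helpers

open scoped MatrixOrder

lemma one_le_det_one_add {n : Type*} [Fintype n] [DecidableEq n] {K : Matrix n n ℝ}
    (hK : K.PosSemidef) : 1 ≤ (1 + K).det := by
  have h1 : K.charpoly.eval (-1) = (-1) ^ Fintype.card n * (1 + K).det := by
    rw [Matrix.eval_charpoly, ← Matrix.det_neg]
    congr 1
    ext i j
    by_cases h : i = j <;> simp [Matrix.one_apply, h] <;> ring
  have h2 : K.charpoly.eval (-1)
      = (-1) ^ Fintype.card n * ∏ i, (1 + hK.isHermitian.eigenvalues i) := by
    rw [hK.isHermitian.charpoly_eq, Polynomial.eval_prod, ← Finset.card_univ,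
      ← Finset.prod_const, ← Finset.prod_mul_distrib]
    refine Finset.prod_congr rfl fun i _ => ?_
    simp
    ring
  have h3 : (1 + K).det = ∏ i, (1 + hK.isHermitian.eigenvalues i) :=
    mul_left_cancel₀ (pow_ne_zero _ (by norm_num)) (h1.symm.trans h2)
  rw [h3]
  calc (1 : ℝ) = ∏ _i : n, (1 : ℝ) := by simp
    _ ≤ _ := Finset.prod_le_prod (fun _ _ => zero_le_one)
      (fun i _ => by linarith [hK.eigenvalues_nonneg i])

lemma det_le_det_add {n : Type*} [Fintype n] [DecidableEq n] {M N : Matrix n n ℝ}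
    (hM : M.PosDef) (hN : N.PosSemidef) : M.det ≤ (M + N).det := by
  obtain ⟨F, rfl⟩ := CStarAlgebra.nonneg_iff_eq_star_mul_self.mp hN.nonneg
  have hu : IsUnit M.det := hM.det_pos.ne'.isUnit
  have h : M + star F * F = M * (1 + (M⁻¹ * star F) * F) := by
    rw [mul_add, mul_one, mul_assoc, Matrix.mul_nonsing_inv_cancel_left _ _ hu]
  rw [h, Matrix.det_mul, Matrix.det_one_add_mul_comm]
  refine le_mul_of_one_le_right hM.det_pos.le (one_le_det_one_add ?_)
  rw [← mul_assoc]
  exact hM.inv.posSemidef.mul_mul_conjTranspose_same F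

lemma schur_posDef {m n : Type*} [Fintype m] [DecidableEq m] [Fintype n] [DecidableEq n]
    {P : Matrix m m ℝ} {X : Matrix m n ℝ} {Q : Matrix n n ℝ}
    (h : (fromBlocks P X Xᴴ Q).PosDef) (hQ : Q.PosDef) : (P - X * Q⁻¹ * Xᴴ).PosDef := by
  haveI : Invertible Q := Q.invertibleOfIsUnitDet hQ.det_pos.ne'.isUnit
  rw [((Matrix.PosDef.fromBlocks₂₂ P X hQ).1 h.posSemidef).posDef_iff_det_ne_zero]
  have := h.det_pos.ne'
  rw [Matrix.det_fromBlocks₂₂, Matrix.invOf_eq_nonsing_inv] at this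
  exact right_ne_zero_of_mul this

lemma fischer {m n : Type*} [Fintype m] [DecidableEq m] [Fintype n] [DecidableEq n]
    {P : Matrix m m ℝ} {X : Matrix m n ℝ} {Q : Matrix n n ℝ}
    (h : (fromBlocks P X Xᴴ Q).PosDef) (hQ : Q.PosDef) :
    (fromBlocks P X Xᴴ Q).det ≤ P.det * Q.det := by
  haveI : Invertible Q := Q.invertibleOfIsUnitDet hQ.det_pos.ne'.isUnit
  have h1 := det_le_det_add (schur_posDef h hQ) (hQ.inv.posSemidef.mul_mul_conjTranspose_same X)
  rw [sub_add_cancel] at h1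
  rw [Matrix.det_fromBlocks₂₂, Matrix.invOf_eq_nonsing_inv, mul_comm]
  exact mul_le_mul_of_nonneg_right h1 hQ.det_pos.le

lemma subm_posDef {S : Matrix V V ℝ} (hS : S.PosDef) (A : Finset V) : (subm S A A).PosDef :=
  hS.submatrix Subtype.val_injective

lemma subm_conjTranspose {S : Matrix V V ℝ} (hS : S.PosDef) (A B : Finset V) :
    (subm S A B)ᴴ = subm S B A := by
  ext i j
  exact hS.isHermitian.apply _ _

lemma pcov_posDef {S : Matrix V V ℝ} (hS : S.PosDef) {A C : Finset V} (hAC : Disjoint A C) :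
    (pcov S A C).PosDef := by
  unfold pcov
  rw [← subm_conjTranspose hS A C]
  refine schur_posDef ?_ (subm_posDef hS C)
  have h := (subm_posDef hS (A ∪ C)).submatrix (Equiv.Finset.union A C hAC).injective
  convert h using 1
  rw [subm_conjTranspose hS]
  ext i j
  rcases i with i | i <;> rcases j with j | j <;> rfl

end Helpers

/-- the partial vector alienation coefficient lies in (0, 1];
equivalently, the squared partial vector correlation lies in [0, 1). -/
theorem alienCond_mem_Ioc
    (S : Matrix V V ℝ) (hS : S.PosDef) (A B C : Finset V)
    (hAB : Disjoint A B) (hAC : Disjoint A C) (hBC : Disjoint B C)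
    (hA : A.Nonempty) (hB : B.Nonempty) :
    (0 < alienCond S A B C ∧ alienCond S A B C ≤ 1) ∧
    (0 ≤ rho2Cond S A B C ∧ rho2Cond S A B C < 1) := by
  have hABC : Disjoint (A ∪ B) C := Finset.disjoint_union_left.2 ⟨hAC, hBC⟩
  have hP := pcov_posDef hS hABC
  have hPA := pcov_posDef hS hAC
  have hPB := pcov_posDef hS hBC
  have key : (pcov S (A ∪ B) C).det ≤ (pcov S A C).det * (pcov S B C).det := by
    have e := Matrix.det_submatrix_equiv_self (Equiv.Finset.union A B hAB) (pcov S (A ∪ B) C)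
    have hp := hP.submatrix (Equiv.Finset.union A B hAB).injective
    set T := (pcov S (A ∪ B) C).submatrix (Equiv.Finset.union A B hAB)
      (Equiv.Finset.union A B hAB) with hT
    have hTb : T = fromBlocks (pcov S A C) T.toBlocks₁₂ T.toBlocks₁₂ᴴ (pcov S B C) := by
      ext i j
      rcases i with i | i <;> rcases j with j | j
      · rfl
      · rfl
      · exact (hp.isHermitian.apply _ _).symm
      · rfl
    rw [← e]
    rw [hTb] at hp ⊢
    exact fischer hp hPB
  have hpos : 0 < (pcov S A C).det * (pcov S B C).det := mul_pos hPA.det_pos hPB.det_pos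
  have h0 : 0 < alienCond S A B C := div_pos hP.det_pos hpos
  have h1 : alienCond S A B C ≤ 1 := (div_le_one hpos).2 key
  refine ⟨⟨h0, h1⟩, ?_⟩
  have hr : rho2Cond S A B C = 1 - alienCond S A B C := by
    simp [rho2Cond, hA.ne_empty, hB.ne_empty]
  rw [hr]
  constructor <;> linarith
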